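/- For the cusp-of-Gauss normal form h(u,v) = v² + q₂₁u²v + q₀₃v³ + q₄₀u⁴ + (higher terms) with q₂₁ ≠ 0 and q₂₁² − 4q₄₀ ≠ 0, the extended affine asymptotic BDE evaluated at the origin reduces to −48q₂₁² dv² = 0, so the unique affine asymptotic direction at the origin is (du,dv) = (1,0); moreover the 2-jets of the Euclidean parabolic set and of the affine parabolic set in this chart are v = ((q₂₁² − 6q₄₀)/q₂₁)u² and v = 2((4q₂₁² − 17q₄₀)/q₂₁)u² respectively, so the two parabolic curves are tangent (contact of order two) at the origin. -/

import Mathlib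

noncomputable section

/-- Partial derivative in the first variable. -/
def pd1 (f : ℝ → ℝ → ℝ) (u v : ℝ) : ℝ := deriv (fun t => f t v) u

/-- Partial derivative in the second variable. -/
def pd2 (f : ℝ → ℝ → ℝ) (u v : ℝ) : ℝ := deriv (fun t => f u t) v

def h_u (h : ℝ → ℝ → ℝ) := pd1 h
def h_v (h : ℝ → ℝ → ℝ) := pd2 h
def h_uu (h : ℝ → ℝ → ℝ) := pd1 (pd1 h)
def h_uv (h : ℝ → ℝ → ℝ) := pd2 (pd1 h)
def h_vv (h : ℝ → ℝ → ℝ) := pd2 (pd2 h)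
def h_uuu (h : ℝ → ℝ → ℝ) := pd1 (h_uu h)
def h_uuv (h : ℝ → ℝ → ℝ) := pd2 (h_uu h)
def h_uvv (h : ℝ → ℝ → ℝ) := pd2 (h_uv h)
def h_vvv (h : ℝ → ℝ → ℝ) := pd2 (h_vv h)
def h_uuuu (h : ℝ → ℝ → ℝ) := pd1 (h_uuu h)
def h_uuuv (h : ℝ → ℝ → ℝ) := pd2 (h_uuu h)
def h_uuvv (h : ℝ → ℝ → ℝ) := pd2 (h_uuv h)
def h_uvvv (h : ℝ → ℝ → ℝ) := pd2 (h_uvv h)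
def h_vvvv (h : ℝ → ℝ → ℝ) := pd2 (h_vvv h)

/-- Hessian determinant `h_uu h_vv - h_uv²` (zero set = Euclidean parabolic set). -/
def hessDet (h : ℝ → ℝ → ℝ) (u v : ℝ) : ℝ :=
  h_uu h u v * h_vv h u v - (h_uv h u v) ^ 2

/-- Coefficient `A` of the extended BDE of affine asymptotic lines in a Monge chart
(the numerator of `l`). -/
def Abde (h : ℝ → ℝ → ℝ) (u v : ℝ) : ℝ :=
  -(-4 * (h_vv h u v * h_uuuu h u v - 2 * h_uv h u v * h_uuuv h u v) * hessDet h u v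
    - 4 * h_uu h u v * hessDet h u v * h_uuvv h u v
    + 7 * (h_vv h u v) ^ 2 * (h_uuu h u v) ^ 2 + 3 * (h_uu h u v) ^ 2 * (h_uvv h u v) ^ 2
    + (-28 * h_uuv h u v * h_uv h u v * h_vv h u v
        + 2 * (h_uu h u v * h_vv h u v + 8 * (h_uv h u v) ^ 2) * h_uvv h u v
        - 4 * h_vvv h u v * h_uu h u v * h_uv h u v) * h_uuu h u v
    + 12 * (h_uu h u v * h_vv h u v + (h_uv h u v) ^ 2) * (h_uuv h u v) ^ 2
    + 4 * ((h_uu h u v) ^ 2 * h_vvv h u v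
        - 6 * h_uu h u v * h_uv h u v * h_uvv h u v) * h_uuv h u v)

/-- Coefficient `B` of the extended BDE (the numerator of `m`). -/
def Bbde (h : ℝ → ℝ → ℝ) (u v : ℝ) : ℝ :=
  -(-4 * (h_vv h u v * h_uuuv h u v - 2 * h_uv h u v * h_uuvv h u v) * hessDet h u v
    + (7 * (h_vv h u v) ^ 2 * h_uuv h u v - 10 * h_uv h u v * h_vv h u v * h_uvv h u v
        + (-(h_uu h u v) * h_vv h u v + 4 * (h_uv h u v) ^ 2) * h_vvv h u v) * h_uuu h u v
    - 4 * hessDet h u v * h_uvvv h u v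
    - 18 * (h_uuv h u v) ^ 2 * h_uv h u v * h_vv h u v
    + 7 * h_uvv h u v * h_vvv h u v * (h_uu h u v) ^ 2
    + ((15 * h_uu h u v * h_vv h u v + 24 * (h_uv h u v) ^ 2) * h_uvv h u v
        - 10 * h_uu h u v * h_uv h u v * h_vvv h u v) * h_uuv h u v
    - 18 * (h_uvv h u v) ^ 2 * h_uu h u v * h_uv h u v)

/-- Coefficient `C` of the extended BDE (the numerator of `n`). -/
def Cbde (h : ℝ → ℝ → ℝ) (u v : ℝ) : ℝ :=
  -(-4 * (h_vv h u v * h_uuvv h u v - 2 * h_uv h u v * h_uvvv h u v) * hessDet h u v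
    - 4 * h_uu h u v * h_vvvv h u v * hessDet h u v
    + 4 * (-(h_uv h u v) * h_vv h u v * h_vvv h u v
        + h_uvv h u v * (h_vv h u v) ^ 2) * h_uuu h u v
    + 3 * (h_uuv h u v) ^ 2 * (h_vv h u v) ^ 2
    + 2 * (-12 * h_uv h u v * h_vv h u v * h_uvv h u v
        + (h_uu h u v * h_vv h u v + 8 * (h_uv h u v) ^ 2) * h_vvv h u v) * h_uuv h u v
    + 12 * (h_uu h u v * h_vv h u v + (h_uv h u v) ^ 2) * (h_uvv h u v) ^ 2
    - 28 * h_uvv h u v * h_vvv h u v * h_uu h u v * h_uv h u v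
    + 7 * (h_vvv h u v) ^ 2 * (h_uu h u v) ^ 2)

/-- Discriminant of the extended BDE `A du² + 2B du dv + C dv² = 0`. -/
def deltaBde (h : ℝ → ℝ → ℝ) (u v : ℝ) : ℝ :=
  (Bbde h u v) ^ 2 - Abde h u v * Cbde h u v

open Asymptotics Filter Topology

/-- `f` agrees with `a + b t + c t²` to second order at the origin. -/
def HasJet2 (f : ℝ → ℝ) (a b c : ℝ) : Prop :=
  (fun t => f t - (a + b * t + c * t ^ 2)) =o[𝓝 0] fun t => t ^ 2

namespace HasJet2

variable {f g : ℝ → ℝ} {a b c a' b' c' : ℝ}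

theorem of_eq (hf : HasJet2 f a b c) (ha : a = a') (hb : b = b') (hc : c = c') :
    HasJet2 f a' b' c' := by
  subst ha hb hc
  exact hf

theorem const (k : ℝ) : HasJet2 (fun _ => k) k 0 0 := by
  simp [HasJet2]

theorem add (hf : HasJet2 f a b c) (hg : HasJet2 g a' b' c') :
    HasJet2 (fun t => f t + g t) (a + a') (b + b') (c + c') :=
  (IsLittleO.add hf hg).congr_left fun t => by ring

theorem neg (hf : HasJet2 f a b c) : HasJet2 (fun t => -f t) (-a) (-b) (-c) :=
  (IsLittleO.neg_left hf).congr_left fun t => by ring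

theorem sub (hf : HasJet2 f a b c) (hg : HasJet2 g a' b' c') :
    HasJet2 (fun t => f t - g t) (a - a') (b - b') (c - c') :=
  (IsLittleO.sub hf hg).congr_left fun t => by ring

theorem apply_zero (hf : HasJet2 f a b c) : f 0 = a := by
  have h := (IsLittleO.isBigO hf).eq_zero_imp.self_of_nhds
  simpa [sub_eq_zero] using h

theorem isBigO_one (hf : HasJet2 f a b c) : f =O[𝓝 0] fun _ => (1 : ℝ) := by
  have hpow : (fun t : ℝ => t ^ 2) =O[𝓝 0] fun _ => (1 : ℝ) :=
    (by fun_prop : Continuous fun t : ℝ => t ^ 2).continuousAt.isBigO_one ℝ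
  have hpoly : (fun t : ℝ => a + b * t + c * t ^ 2) =O[𝓝 0] fun _ => (1 : ℝ) :=
    (by fun_prop : Continuous fun t : ℝ => a + b * t + c * t ^ 2).continuousAt.isBigO_one ℝ
  exact ((IsLittleO.isBigO hf).trans hpow |>.add hpoly).congr_left fun t => by ring

theorem mul (hf : HasJet2 f a b c) (hg : HasJet2 g a' b' c') :
    HasJet2 (fun t => f t * g t) (a * a') (a * b' + b * a') (a * c' + b * b' + c * a') := by
  have hpoly : (fun t : ℝ => a + b * t + c * t ^ 2) =O[𝓝 0] fun _ => (1 : ℝ) :=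
    (by fun_prop : Continuous fun t : ℝ => a + b * t + c * t ^ 2).continuousAt.isBigO_one ℝ
  have hleft := IsLittleO.mul_isBigO hf hg.isBigO_one
  have hright := hpoly.mul_isLittleO hg
  have hcube : (fun t : ℝ => t ^ 3) =o[𝓝 0] fun t => t ^ 2 := isLittleO_pow_pow (by norm_num)
  have htail := ((by fun_prop : Continuous fun t : ℝ =>
    b * c' + c * b' + c * c' * t).continuousAt (x := 0)).isBigO_one ℝ |>.mul_isLittleO hcube
  simp only [mul_one, one_mul] at hleft hright htail
  exact ((hleft.add hright).add htail).congr_left fun t => by ring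

theorem sq (hf : HasJet2 f a b c) :
    HasJet2 (fun t => f t ^ 2) (a * a) (a * b + b * a) (a * c + b * b + c * a) := by
  simpa only [pow_two] using hf.mul hf

theorem eq_zero_of_zero (h : HasJet2 (fun _ => 0) a b c) : a = 0 ∧ b = 0 ∧ c = 0 := by
  have hpoly : (fun t : ℝ => a + b * t + c * t ^ 2) =o[𝓝 0] fun t => t ^ 2 :=
    (IsLittleO.neg_left h).congr_left fun t => by ring
  have hmonomial : ∀ (k : ℝ) (n : ℕ),
      (fun t : ℝ => k * t ^ n) =o[𝓝 0] (fun t => t ^ n) → k = 0 := by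
    intro k n hk
    by_contra hne
    refine isLittleO_irrefl ?_ ((isLittleO_const_mul_left_iff hne).1 hk)
    exact ((eventually_mem_nhdsWithin (a := (0 : ℝ)) (s := {0}ᶜ)).mono
      fun t ht => pow_ne_zero n ht).frequently.filter_mono nhdsWithin_le_nhds
  have ha : a = 0 := h.apply_zero.symm
  have hb : b = 0 := by
    refine hmonomial b 1 ?_
    have hsq : (fun t : ℝ => t ^ 2) =o[𝓝 0] fun t => t ^ 1 := isLittleO_pow_pow one_lt_two
    exact ((hpoly.trans hsq).sub (hsq.const_mul_left c)).congr_left fun t => by rw [ha]; ring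
  exact ⟨ha, hb, hmonomial c 2 (hpoly.congr_left fun t => by rw [ha, hb]; ring)⟩

theorem unique (hf : HasJet2 f a b c) (hg : HasJet2 f a' b' c') :
    a = a' ∧ b = b' ∧ c = c' := by
  have h := (hf.sub hg)
  simp only [sub_self] at h
  obtain ⟨h0, h1, h2⟩ := h.eq_zero_of_zero
  exact ⟨sub_eq_zero.1 h0, sub_eq_zero.1 h1, sub_eq_zero.1 h2⟩

theorem of_hasDerivAt {f' : ℝ → ℝ} (hf : ∀ t, HasDerivAt f (f' t) t) (hf' : HasDerivAt f' c 0) :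
    HasJet2 f (f 0) (f' 0) (c / 2) := by
  have hder : ∀ t ∈ Set.univ, HasDerivWithinAt (fun t => f t - (f' 0 * t + c / 2 * t ^ 2))
      (f' t - f' 0 - c * t) Set.univ t := fun t _ => by
    have hlin := ((hasDerivAt_id t).const_mul (f' 0)).add
      (((hasDerivAt_id t).pow 2).const_mul (c / 2))
    refine (((hf t).sub hlin).congr_deriv ?_).hasDerivWithinAt
    simp
    ring
  have hsmall : (fun t => f' t - f' 0 - c * t) =o[𝓝[Set.univ] 0] fun t => (t - 0) ^ 1 := by
    have := hf'.isLittleO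
    simpa [mul_comm] using this
  have := convex_univ.isLittleO_pow_succ_real (Set.mem_univ (0 : ℝ)) hder hsmall
  simp only [nhdsWithin_univ, sub_zero] at this
  exact this.congr_left fun t => by ring

end HasJet2

/-- Joint smoothness of a function of two real variables. -/
def Smooth2 (f : ℝ → ℝ → ℝ) : Prop :=
  ContDiff ℝ (⊤ : ℕ∞) fun p : ℝ × ℝ => f p.1 p.2

namespace Smooth2

variable {f : ℝ → ℝ → ℝ}

theorem hasFDerivAt (hf : Smooth2 f) (p : ℝ × ℝ) :
    HasFDerivAt (fun p : ℝ × ℝ => f p.1 p.2) (fderiv ℝ (fun p : ℝ × ℝ => f p.1 p.2) p) p :=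
  (ContDiff.differentiable hf (by simp) p).hasFDerivAt

theorem hasDerivAt_comp (hf : Smooth2 f) {x y : ℝ → ℝ} {x' y' t : ℝ}
    (hx : HasDerivAt x x' t) (hy : HasDerivAt y y' t) :
    HasDerivAt (fun t => f (x t) (y t))
      (fderiv ℝ (fun p : ℝ × ℝ => f p.1 p.2) (x t, y t) (x', y')) t :=
  HasFDerivAt.comp_hasDerivAt (l := fun p : ℝ × ℝ => f p.1 p.2) t
    (hf.hasFDerivAt (x t, y t)) (hx.prodMk hy)

theorem pd1_eq (hf : Smooth2 f) (u v : ℝ) :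
    pd1 f u v = fderiv ℝ (fun p : ℝ × ℝ => f p.1 p.2) (u, v) (1, 0) :=
  (hf.hasDerivAt_comp (hasDerivAt_id u) (hasDerivAt_const u v)).deriv

theorem pd2_eq (hf : Smooth2 f) (u v : ℝ) :
    pd2 f u v = fderiv ℝ (fun p : ℝ × ℝ => f p.1 p.2) (u, v) (0, 1) :=
  (hf.hasDerivAt_comp (hasDerivAt_const v u) (hasDerivAt_id v)).deriv

theorem fderiv_apply (hf : Smooth2 f) (u v a b : ℝ) :
    fderiv ℝ (fun p : ℝ × ℝ => f p.1 p.2) (u, v) (a, b) = pd1 f u v * a + pd2 f u v * b := by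
  have hab : ((a, b) : ℝ × ℝ) = a • (1, 0) + b • (0, 1) := by simp
  rw [hab, map_add, map_smul, map_smul, ← hf.pd1_eq, ← hf.pd2_eq]
  simp [mul_comm]

theorem hasDerivAt_curve (hf : Smooth2 f) {x y : ℝ → ℝ} {x' y' t : ℝ}
    (hx : HasDerivAt x x' t) (hy : HasDerivAt y y' t) :
    HasDerivAt (fun t => f (x t) (y t)) (pd1 f (x t) (y t) * x' + pd2 f (x t) (y t) * y') t :=
  (hf.hasDerivAt_comp hx hy).congr_deriv (hf.fderiv_apply _ _ _ _)

theorem fderiv_const (hf : Smooth2 f) (e : ℝ × ℝ) :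
    ContDiff ℝ (⊤ : ℕ∞) fun p => fderiv ℝ (fun p : ℝ × ℝ => f p.1 p.2) p e :=
  (ContDiff.fderiv_right hf (by simp)).clm_apply contDiff_const

theorem smooth_pd1 (hf : Smooth2 f) : Smooth2 (pd1 f) := by
  simpa only [Smooth2, hf.pd1_eq] using hf.fderiv_const (1, 0)

theorem smooth_pd2 (hf : Smooth2 f) : Smooth2 (pd2 f) := by
  simpa only [Smooth2, hf.pd2_eq] using hf.fderiv_const (0, 1)

theorem hasJet2_curve (hf : Smooth2 f) {η η' : ℝ → ℝ} {e : ℝ} (hη : ∀ t, HasDerivAt η (η' t) t)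
    (hη' : HasDerivAt η' e 0) (h0 : η 0 = 0) (h0' : η' 0 = 0) :
    HasJet2 (fun t => f t (η t)) (f 0 0) (pd1 f 0 0)
      ((pd1 (pd1 f) 0 0 + pd2 f 0 0 * e) / 2) := by
  have hder (t : ℝ) := hf.hasDerivAt_curve (hasDerivAt_id t) (hη t)
  have hder1 := (hf.smooth_pd1.hasDerivAt_curve (hasDerivAt_id 0) (hη 0)).mul_const 1
  have hder2 := (hf.smooth_pd2.hasDerivAt_curve (hasDerivAt_id 0) (hη 0)).mul hη'
  have := HasJet2.of_hasDerivAt hder (hder1.add hder2)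
  refine this.of_eq ?_ ?_ ?_ <;> simp [h0, h0']

theorem hasJet2_parabola (hf : Smooth2 f) (s : ℝ) :
    HasJet2 (fun t => f t (s * t ^ 2)) (f 0 0) (pd1 f 0 0)
      (pd1 (pd1 f) 0 0 / 2 + pd2 f 0 0 * s) := by
  have hη (t : ℝ) : HasDerivAt (fun t => s * t ^ 2) (2 * s * t) t :=
    (((hasDerivAt_id t).pow 2).const_mul s).congr_deriv (by simp; ring)
  have hη' : HasDerivAt (fun t => 2 * s * t) (2 * s) 0 := by
    simpa using (hasDerivAt_id (0 : ℝ)).const_mul (2 * s)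
  exact (hf.hasJet2_curve hη hη' (by simp) (by simp)).of_eq rfl rfl (by ring)

end Smooth2

/-- If `η` is smooth near the origin, then some globally smooth function has the same germ. -/
theorem exists_contDiff_eventuallyEq {η : ℝ → ℝ}
    (hη : ∀ᶠ x in 𝓝 (0 : ℝ), ContDiffAt ℝ (⊤ : ℕ∞) η x) :
    ∃ ζ : ℝ → ℝ, ContDiff ℝ (⊤ : ℕ∞) ζ ∧ ζ =ᶠ[𝓝 0] η := by
  obtain ⟨ε, hε, hball⟩ := Metric.eventually_nhds_iff_ball.1 hη
  let φ : ContDiffBump (0 : ℝ) := ⟨ε / 3, ε / 2, by positivity, by linarith⟩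
  refine ⟨fun x => φ x * η x, contDiff_iff_contDiffAt.2 fun x => ?_, ?_⟩
  · by_cases hx : x ∈ Metric.ball 0 ε
    · exact φ.contDiffAt.mul (hball x hx)
    · have hx' : x ∉ tsupport φ := by
        rw [φ.tsupport_eq]
        simp only [Metric.mem_ball, Metric.mem_closedBall, not_lt, not_le] at hx ⊢
        exact (half_lt_self hε).trans_le hx
      refine (contDiffAt_const (c := (0 : ℝ))).congr_of_eventuallyEq ?_
      filter_upwards [notMem_tsupport_iff_eventuallyEq.1 hx'] with y hy
      simp [hy]
  · filter_upwards [φ.eventuallyEq_one] with x hx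
    simp [hx]

/-- A smooth function whose second partial derivative is nonzero at a zero has, near that zero,
a smooth branch of solutions. -/
theorem Smooth2.exists_implicit {F : ℝ → ℝ → ℝ} (hF : Smooth2 F) (h0 : F 0 0 = 0)
    (hpd : pd2 F 0 0 ≠ 0) :
    ∃ η : ℝ → ℝ, ContDiff ℝ (⊤ : ℕ∞) η ∧ η 0 = 0 ∧ ∀ᶠ u in 𝓝 (0 : ℝ), F u (η u) = 0 := by
  have hcd (p : ℝ × ℝ) : ContDiffAt ℝ (⊤ : ℕ∞) (fun p : ℝ × ℝ => F p.1 p.2) p :=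
    ContDiff.contDiffAt hF
  have htop : (((⊤ : ℕ∞) : WithTop ℕ∞)) ≠ 0 := by simp
  have hinv (p : ℝ × ℝ) (hp : pd2 F p.1 p.2 ≠ 0) :
      (fderiv ℝ (fun p : ℝ × ℝ => F p.1 p.2) p ∘L .inr ℝ ℝ ℝ).IsInvertible := by
    refine ⟨ContinuousLinearEquiv.unitsEquivAut ℝ (Units.mk0 _ hp), ?_⟩
    ext
    simpa using (hF.pd2_eq p.1 p.2)
  let ψ (p : ℝ × ℝ) (hp : pd2 F p.1 p.2 ≠ 0) : ℝ → ℝ := (hcd p).implicitFunction htop (hinv p hp)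
  let η := ψ (0, 0) hpd
  have hη0 : η 0 = 0 := (hcd (0, 0)).implicitFunction_apply_self htop (hinv _ hpd)
  have hηF : ∀ᶠ u in 𝓝 (0 : ℝ), F u (η u) = 0 := by
    simpa only [h0] using (hcd (0, 0)).eventually_apply_implicitFunction htop (hinv _ hpd)
  have hη1 : ContDiffAt ℝ 1 η 0 :=
    ((hcd (0, 0)).contDiffAt_implicitFunction htop (hinv _ hpd)).of_le (by simp)
  have hne : ∀ᶠ u in 𝓝 (0 : ℝ), pd2 F u (η u) ≠ 0 := by
    have hcont : ContinuousAt (fun u => pd2 F u (η u)) 0 :=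
      (ContDiff.continuous hF.smooth_pd2).continuousAt.comp (f := fun u => (u, η u))
        (continuousAt_id.prodMk hη1.continuousAt)
    exact hcont.eventually_ne (by simpa only [hη0] using hpd)
  have hsmooth : ∀ᶠ x in 𝓝 (0 : ℝ), ContDiffAt ℝ (⊤ : ℕ∞) η x := by
    filter_upwards [hηF.eventually_nhds, hne, hη1.eventually (by simp)] with x hx hx' hx1
    refine ((hcd (x, η x)).contDiffAt_implicitFunction htop (hinv _ hx')).congr_of_eventuallyEq ?_
    have htend : Tendsto (fun u => (u, η u)) (𝓝 x) (𝓝 (x, η x)) :=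
      continuousAt_id.prodMk hx1.continuousAt
    filter_upwards [htend.eventually ((hcd (x, η x)).eventually_apply_eq_iff_implicitFunction htop
      (hinv _ hx')), hx] with u hu huF
    exact (hu.1 (huF.trans hx.self_of_nhds.symm)).symm
  obtain ⟨ζ, hζ, hζη⟩ := exists_contDiff_eventuallyEq hsmooth
  refine ⟨ζ, hζ, hζη.self_of_nhds.trans hη0, ?_⟩
  filter_upwards [hηF, hζη] with u hu hζu
  rwa [hζu]

/-- If `F u (s u²) = (a + b s) u² + o(u²)` for every `s`, with `b ≠ 0`, then the zero set of `F`
contains a smooth curve with 2-jet `v = -(a / b) u²`. -/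
theorem Smooth2.exists_zero_curve {F : ℝ → ℝ → ℝ} (hF : Smooth2 F) {a b : ℝ} (hb : b ≠ 0)
    (hjet : ∀ s, HasJet2 (fun t => F t (s * t ^ 2)) 0 0 (a + b * s)) :
    ∃ η : ℝ → ℝ, ContDiff ℝ (⊤ : ℕ∞) η ∧ η 0 = 0 ∧ deriv η 0 = 0 ∧
      deriv (deriv η) 0 / 2 = -a / b ∧ ∀ᶠ u in 𝓝 (0 : ℝ), F u (η u) = 0 := by
  obtain ⟨hF0, hF1, ha⟩ := (hF.hasJet2_parabola 0).unique (hjet 0)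
  obtain ⟨-, -, hab⟩ := (hF.hasJet2_parabola 1).unique (hjet 1)
  have hF2 : pd2 F 0 0 = b := by linarith
  obtain ⟨η, hη, hη0, hzero⟩ := hF.exists_implicit hF0 (hF2 ▸ hb)
  have hder (t : ℝ) : HasDerivAt η (deriv η t) t :=
    (hη.differentiable (by simp) t).hasDerivAt
  have hder' : HasDerivAt (deriv η) (deriv (deriv η) 0) 0 :=
    ((hη.iterate_deriv 1).differentiable (by simp) 0).hasDerivAt
  have hη' : deriv η 0 = 0 := by
    have hchain := (hF.hasDerivAt_curve (hasDerivAt_id 0) (hder 0)).deriv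
    have hz : deriv (fun t => F (id t) (η t)) 0 = 0 := by
      simpa using (show (fun t => F (id t) (η t)) =ᶠ[𝓝 0] fun _ => 0 from hzero).deriv_eq
    rw [hz] at hchain
    simp only [id, hη0, hF1, hF2, zero_mul, zero_add] at hchain
    exact (mul_eq_zero.1 hchain.symm).resolve_left hb
  refine ⟨η, hη, hη0, hη', ?_, hzero⟩
  have hzjet : HasJet2 (fun t => F t (η t)) 0 0 0 :=
    (HasJet2.const 0).congr' (hzero.mono fun t ht => by simp [ht]) EventuallyEq.rfl
  obtain ⟨-, -, h2⟩ := (hF.hasJet2_curve hder hder' hη0 hη').unique hzjet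
  rw [hF2] at h2
  field_simp
  linarith

/-- The partial derivatives of `f` of order at most `n` vanish at the origin. -/
def Flat (n : ℕ) (f : ℝ → ℝ → ℝ) : Prop :=
  Smooth2 f ∧ ∀ k ≤ n, iteratedFDeriv ℝ k (fun p : ℝ × ℝ => f p.1 p.2) (0, 0) = 0

namespace Flat

variable {n : ℕ} {f : ℝ → ℝ → ℝ}

theorem smooth (hf : Flat n f) : Smooth2 f := hf.1

theorem eq_zero (hf : Flat n f) : f 0 0 = 0 := by
  have h := congrArg (fun L => L (fun _ => 0)) (hf.2 0 n.zero_le)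
  simpa using h

theorem iteratedFDeriv_fderiv_apply (hf : Flat (n + 1) f) (e : ℝ × ℝ) {k : ℕ} (hk : k ≤ n) :
    iteratedFDeriv ℝ k (fun p => fderiv ℝ (fun p : ℝ × ℝ => f p.1 p.2) p e) (0, 0) = 0 := by
  have hsmooth : ContDiff ℝ (⊤ : ℕ∞) (fderiv ℝ fun p : ℝ × ℝ => f p.1 p.2) :=
    ContDiff.fderiv_right hf.smooth (by simp)
  have hle := norm_iteratedFDeriv_clm_apply_const (c := e) (n := k)
    (hsmooth.contDiffAt (x := (0, 0))) (by exact_mod_cast le_top)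
  rw [norm_iteratedFDeriv_fderiv, hf.2 (k + 1) (by omega), norm_zero, mul_zero] at hle
  exact norm_le_zero_iff.1 hle

theorem flat_pd1 (hf : Flat (n + 1) f) : Flat n (pd1 f) := by
  refine ⟨hf.smooth.smooth_pd1, fun k hk => ?_⟩
  simpa only [hf.smooth.pd1_eq] using hf.iteratedFDeriv_fderiv_apply (1, 0) hk

theorem flat_pd2 (hf : Flat (n + 1) f) : Flat n (pd2 f) := by
  refine ⟨hf.smooth.smooth_pd2, fun k hk => ?_⟩
  simpa only [hf.smooth.pd2_eq] using hf.iteratedFDeriv_fderiv_apply (0, 1) hk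

end Flat

/-- The polynomial of degree at most four with coefficients `aᵢⱼ` of `uⁱ vʲ`, plus `r`. -/
def quarticAdd (a00 a10 a01 a20 a11 a02 a30 a21 a12 a03 a40 a31 a22 a13 a04 : ℝ)
    (r : ℝ → ℝ → ℝ) (u v : ℝ) : ℝ :=
  a00 + a10 * u + a01 * v + a20 * u ^ 2 + a11 * u * v + a02 * v ^ 2
    + a30 * u ^ 3 + a21 * u ^ 2 * v + a12 * u * v ^ 2 + a03 * v ^ 3
    + a40 * u ^ 4 + a31 * u ^ 3 * v + a22 * u ^ 2 * v ^ 2 + a13 * u * v ^ 3 + a04 * v ^ 4 + r u v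

section quarticAdd

variable {a00 a10 a01 a20 a11 a02 a30 a21 a12 a03 a40 a31 a22 a13 a04 : ℝ} {r : ℝ → ℝ → ℝ}

theorem hasDerivAt_quartic (b0 b1 b2 b3 b4 t : ℝ) :
    HasDerivAt (fun t => b0 + b1 * t + b2 * t ^ 2 + b3 * t ^ 3 + b4 * t ^ 4)
      (b1 + 2 * b2 * t + 3 * b3 * t ^ 2 + 4 * b4 * t ^ 3) t := by
  have hpow (k : ℝ) (n : ℕ) := (hasDerivAt_pow n t).const_mul k
  refine ((((((hasDerivAt_id t).const_mul b1).const_add b0).add (hpow b2 2)).add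
    (hpow b3 3)).add (hpow b4 4)).congr_deriv ?_
  norm_num
  ring

theorem pd1_quarticAdd (hr : Smooth2 r) :
    pd1 (quarticAdd a00 a10 a01 a20 a11 a02 a30 a21 a12 a03 a40 a31 a22 a13 a04 r) =
      quarticAdd a10 (2 * a20) a11 (3 * a30) (2 * a21) a12 (4 * a40) (3 * a31) (2 * a22) a13
        0 0 0 0 0 (pd1 r) := by
  funext u v
  have hr' : HasDerivAt (fun t => r t v) (pd1 r u v) u := by
    simpa using hr.hasDerivAt_curve (hasDerivAt_id u) (hasDerivAt_const u v)
  have hpoly := hasDerivAt_quartic (a00 + a01 * v + a02 * v ^ 2 + a03 * v ^ 3 + a04 * v ^ 4)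
    (a10 + a11 * v + a12 * v ^ 2 + a13 * v ^ 3) (a20 + a21 * v + a22 * v ^ 2) (a30 + a31 * v) a40 u
  refine Eq.trans ?_ ((hpoly.add hr').deriv.trans ?_)
  · refine congrArg (fun g => deriv g u) (funext fun t => ?_)
    simp only [quarticAdd, Pi.add_apply]
    ring
  · simp only [quarticAdd]
    ring

theorem pd2_quarticAdd (hr : Smooth2 r) :
    pd2 (quarticAdd a00 a10 a01 a20 a11 a02 a30 a21 a12 a03 a40 a31 a22 a13 a04 r) =
      quarticAdd a01 a11 (2 * a02) a21 (2 * a12) (3 * a03) a31 (2 * a22) (3 * a13) (4 * a04)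
        0 0 0 0 0 (pd2 r) := by
  funext u v
  have hr' : HasDerivAt (fun t => r u t) (pd2 r u v) v := by
    simpa using hr.hasDerivAt_curve (hasDerivAt_const v u) (hasDerivAt_id v)
  have hpoly := hasDerivAt_quartic (a00 + a10 * u + a20 * u ^ 2 + a30 * u ^ 3 + a40 * u ^ 4)
    (a01 + a11 * u + a21 * u ^ 2 + a31 * u ^ 3) (a02 + a12 * u + a22 * u ^ 2) (a03 + a13 * u) a04 v
  refine Eq.trans ?_ ((hpoly.add hr').deriv.trans ?_)
  · refine congrArg (fun g => deriv g v) (funext fun t => ?_)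
    simp only [quarticAdd, Pi.add_apply]
    ring
  · simp only [quarticAdd]
    ring

theorem quarticAdd_zero :
    quarticAdd a00 a10 a01 a20 a11 a02 a30 a21 a12 a03 a40 a31 a22 a13 a04 r 0 0 =
      a00 + r 0 0 := by
  simp [quarticAdd]

theorem Smooth2.quarticAdd (hr : Smooth2 r) :
    Smooth2 (quarticAdd a00 a10 a01 a20 a11 a02 a30 a21 a12 a03 a40 a31 a22 a13 a04 r) := by
  refine ContDiff.add ?_ hr
  fun_prop

end quarticAdd

namespace Smooth2

variable {h : ℝ → ℝ → ℝ}

theorem hessDet (hh : Smooth2 h) : Smooth2 (hessDet h) := by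
  have huu : Smooth2 (h_uu h) := hh.smooth_pd1.smooth_pd1
  have huv : Smooth2 (h_uv h) := hh.smooth_pd1.smooth_pd2
  have hvv : Smooth2 (h_vv h) := hh.smooth_pd2.smooth_pd2
  exact (ContDiff.mul huu hvv).sub (ContDiff.pow huv 2)

theorem deltaBde (hh : Smooth2 h) : Smooth2 (deltaBde h) := by
  have hdet : Smooth2 (_root_.hessDet h) := hh.hessDet
  have huu : Smooth2 (h_uu h) := hh.smooth_pd1.smooth_pd1
  have huv : Smooth2 (h_uv h) := hh.smooth_pd1.smooth_pd2
  have hvv : Smooth2 (h_vv h) := hh.smooth_pd2.smooth_pd2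
  have huuu : Smooth2 (h_uuu h) := huu.smooth_pd1
  have huuv : Smooth2 (h_uuv h) := huu.smooth_pd2
  have huvv : Smooth2 (h_uvv h) := huv.smooth_pd2
  have hvvv : Smooth2 (h_vvv h) := hvv.smooth_pd2
  have huuuu : Smooth2 (h_uuuu h) := huuu.smooth_pd1
  have huuuv : Smooth2 (h_uuuv h) := huuu.smooth_pd2
  have huuvv : Smooth2 (h_uuvv h) := huuv.smooth_pd2
  have huvvv : Smooth2 (h_uvvv h) := huvv.smooth_pd2
  have hvvvv : Smooth2 (h_vvvv h) := hvvv.smooth_pd2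
  unfold Smooth2 at *
  unfold _root_.deltaBde Abde Bbde Cbde
  fun_prop

end Smooth2

/-- 2-jets, along the parabolas `v = s u²`, of the Hessian determinant and of the coefficients of
the extended BDE at a cusp of Gauss. -/
theorem hasJet2_cusp_of_gauss (q21 q03 q40 q31 q22 q13 q04 s : ℝ) {r h : ℝ → ℝ → ℝ}
    (hr : Flat 4 r) (hh : h = quarticAdd 0 0 0 0 0 1 0 q21 0 q03 q40 q31 q22 q13 q04 r) :
    HasJet2 (fun t => hessDet h t (s * t ^ 2)) 0 0 (4 * (6 * q40 - q21 ^ 2) + 4 * q21 * s) ∧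
    HasJet2 (fun t => Abde h t (s * t ^ 2)) 0 0
      (192 * (-(q21 * (q21 ^ 2 - 4 * q40) * s) - q21 ^ 4 + 18 * q21 ^ 2 * q40 - 60 * q40 ^ 2)) ∧
    (∃ c, HasJet2 (fun t => Bbde h t (s * t ^ 2)) 0 (96 * q21 * (3 * q21 ^ 2 - 14 * q40)) c) ∧
    ∃ b c, HasJet2 (fun t => Cbde h t (s * t ^ 2)) (-48 * q21 ^ 2) b c := by
  have r1 := hr.flat_pd1
  have r2 := hr.flat_pd2
  have r11 := r1.flat_pd1
  have r12 := r1.flat_pd2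
  have r22 := r2.flat_pd2
  have r111 := r11.flat_pd1
  have r112 := r11.flat_pd2
  have r121 := r12.flat_pd1
  have r122 := r12.flat_pd2
  have r221 := r22.flat_pd1
  have r222 := r22.flat_pd2
  have hs : Smooth2 h := hh ▸ hr.smooth.quarticAdd
  have suu : Smooth2 (h_uu h) := hs.smooth_pd1.smooth_pd1
  have suv : Smooth2 (h_uv h) := hs.smooth_pd1.smooth_pd2
  have svv : Smooth2 (h_vv h) := hs.smooth_pd2.smooth_pd2
  have suuu : Smooth2 (h_uuu h) := suu.smooth_pd1
  have suuv : Smooth2 (h_uuv h) := suu.smooth_pd2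
  have suvv : Smooth2 (h_uvv h) := suv.smooth_pd2
  have svvv : Smooth2 (h_vvv h) := svv.smooth_pd2
  have juu := suu.hasJet2_parabola s
  have juv := suv.hasJet2_parabola s
  have jvv := svv.hasJet2_parabola s
  have juuu := suuu.hasJet2_parabola s
  have juuv := suuv.hasJet2_parabola s
  have juvv := suvv.hasJet2_parabola s
  have jvvv := svvv.hasJet2_parabola s
  have juuuu := (show Smooth2 (h_uuuu h) from suuu.smooth_pd1).hasJet2_parabola s
  have juuuv := (show Smooth2 (h_uuuv h) from suuu.smooth_pd2).hasJet2_parabola s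
  have juuvv := (show Smooth2 (h_uuvv h) from suuv.smooth_pd2).hasJet2_parabola s
  have juvvv := (show Smooth2 (h_uvvv h) from suvv.smooth_pd2).hasJet2_parabola s
  have jvvvv := (show Smooth2 (h_vvvv h) from svvv.smooth_pd2).hasJet2_parabola s
  replace juu : HasJet2 (fun t => h_uu h t (s * t ^ 2)) 0 0 (12 * q40 + 2 * q21 * s) := by
    refine juu.of_eq ?_ ?_ ?_ <;>
      simp only [h_uu, hh, pd1_quarticAdd, pd2_quarticAdd, quarticAdd_zero, hr.smooth, r1.smooth,
        r11.smooth, r111.smooth, r11.eq_zero, r111.eq_zero, r111.flat_pd1.eq_zero, r112.eq_zero] <;>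
      ring
  replace juv : HasJet2 (fun t => h_uv h t (s * t ^ 2)) 0 (2 * q21) (3 * q31) := by
    refine juv.of_eq ?_ ?_ ?_ <;>
      simp only [h_uv, hh, pd1_quarticAdd, pd2_quarticAdd, quarticAdd_zero, hr.smooth, r1.smooth,
        r12.smooth, r121.smooth, r12.eq_zero, r121.eq_zero, r121.flat_pd1.eq_zero, r122.eq_zero] <;>
      ring
  replace jvv : HasJet2 (fun t => h_vv h t (s * t ^ 2)) 2 0 (2 * q22 + 6 * q03 * s) := by
    refine jvv.of_eq ?_ ?_ ?_ <;>
      simp only [h_vv, hh, pd1_quarticAdd, pd2_quarticAdd, quarticAdd_zero, hr.smooth, r2.smooth,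
        r22.smooth, r221.smooth, r22.eq_zero, r221.eq_zero, r221.flat_pd1.eq_zero, r222.eq_zero] <;>
      ring
  replace juuu := juuu.of_eq (a' := 0) (b' := 24 * q40) (by
      simp only [h_uuu, h_uu, hh, pd1_quarticAdd, quarticAdd_zero, hr.smooth, r1.smooth,
        r11.smooth, r111.eq_zero]
      ring) (by
      simp only [h_uuu, h_uu, hh, pd1_quarticAdd, quarticAdd_zero, hr.smooth, r1.smooth,
        r11.smooth, r111.smooth, r111.flat_pd1.eq_zero]
      ring) rfl
  have huuv : h_uuv h 0 0 = 2 * q21 := by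
    simp only [h_uuv, h_uu, hh, pd1_quarticAdd, pd2_quarticAdd, quarticAdd_zero, hr.smooth,
      r1.smooth, r11.smooth, r112.eq_zero]
    ring
  have huvv : h_uvv h 0 0 = 0 := by
    simp only [h_uvv, h_uv, hh, pd1_quarticAdd, pd2_quarticAdd, quarticAdd_zero, hr.smooth,
      r1.smooth, r12.smooth, r122.eq_zero]
    ring
  have huuuu : h_uuuu h 0 0 = 24 * q40 := by
    simp only [h_uuuu, h_uuu, h_uu, hh, pd1_quarticAdd, quarticAdd_zero, hr.smooth, r1.smooth,
      r11.smooth, r111.smooth, r111.flat_pd1.eq_zero]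
    ring
  rw [huuv] at juuv
  rw [huvv] at juvv
  rw [huuuu] at juuuu
  have jdet : HasJet2 (fun t => hessDet h t (s * t ^ 2)) 0 0
      (4 * (6 * q40 - q21 ^ 2) + 4 * q21 * s) :=
    ((juu.mul jvv).sub juv.sq).of_eq (by ring) (by ring) (by ring)
  refine ⟨jdet, ?_, ?_, ?_⟩
  · unfold Abde
    apply HasJet2.of_eq
    · with_reducible repeat' first
        | assumption | exact HasJet2.const _ | apply HasJet2.neg | apply HasJet2.add
        | apply HasJet2.sub | apply HasJet2.mul | apply HasJet2.sq
    all_goals ring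
  · unfold Bbde
    apply Exists.intro
    apply HasJet2.of_eq (hc := rfl)
    · with_reducible repeat' first
        | assumption | exact HasJet2.const _ | apply HasJet2.neg | apply HasJet2.add
        | apply HasJet2.sub | apply HasJet2.mul | apply HasJet2.sq
    all_goals ring
  · unfold Cbde
    apply Exists.intro
    apply Exists.intro
    apply HasJet2.of_eq (hb := rfl) (hc := rfl)
    · with_reducible repeat' first
        | assumption | exact HasJet2.const _ | apply HasJet2.neg | apply HasJet2.add
        | apply HasJet2.sub | apply HasJet2.mul | apply HasJet2.sq
    ring

/-- In the cusp-of-Gauss normal form chart (`q₂₁ ≠ 0`, `q₂₁² - 4q₄₀ ≠ 0`),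
the extended affine asymptotic BDE at the origin reduces to `-48q₂₁² dv² = 0`, so the
unique affine asymptotic direction at the origin is `(1,0)`; moreover the Euclidean
parabolic set and the affine parabolic set are graphs with 2-jets
`v = ((q₂₁² - 6q₄₀)/q₂₁)u²` and `v = 2((4q₂₁² - 17q₄₀)/q₂₁)u²` respectively, hence the
two parabolic curves are tangent (contact of order two) at the origin. -/
theorem cusp_of_gauss_affine_bde (q21 q03 q40 q31 q22 q13 q04 : ℝ)
    (hq21 : q21 ≠ 0) (hnd : q21 ^ 2 - 4 * q40 ≠ 0)
    (r : ℝ → ℝ → ℝ) (hr : ContDiff ℝ (⊤ : ℕ∞) (fun p : ℝ × ℝ => r p.1 p.2))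
    (hjet : ∀ k : ℕ, k ≤ 4 → iteratedFDeriv ℝ k (fun p : ℝ × ℝ => r p.1 p.2) (0, 0) = 0)
    (h : ℝ → ℝ → ℝ)
    (hdef : h = fun u v => v ^ 2 + q21 * u ^ 2 * v + q03 * v ^ 3 + q40 * u ^ 4
      + q31 * u ^ 3 * v + q22 * u ^ 2 * v ^ 2 + q13 * u * v ^ 3 + q04 * v ^ 4 + r u v) :
    Abde h 0 0 = 0 ∧ Bbde h 0 0 = 0 ∧ Cbde h 0 0 = -48 * q21 ^ 2 ∧
    (∀ a b : ℝ, ¬(a = 0 ∧ b = 0) →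
      (Abde h 0 0 * a ^ 2 + 2 * Bbde h 0 0 * a * b + Cbde h 0 0 * b ^ 2 = 0 ↔ b = 0)) ∧
    (∃ η₁ η₂ : ℝ → ℝ, ContDiff ℝ (⊤ : ℕ∞) η₁ ∧ ContDiff ℝ (⊤ : ℕ∞) η₂ ∧
      η₁ 0 = 0 ∧ η₂ 0 = 0 ∧ deriv η₁ 0 = 0 ∧ deriv η₂ 0 = 0 ∧
      deriv (deriv η₁) 0 / 2 = (q21 ^ 2 - 6 * q40) / q21 ∧
      deriv (deriv η₂) 0 / 2 = 2 * (4 * q21 ^ 2 - 17 * q40) / q21 ∧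
      (∀ᶠ u : ℝ in nhds 0, hessDet h u (η₁ u) = 0) ∧
      (∀ᶠ u : ℝ in nhds 0, deltaBde h u (η₂ u) = 0) ∧
      deriv η₁ 0 = deriv η₂ 0) := by
  have hh : h = quarticAdd 0 0 0 0 0 1 0 q21 0 q03 q40 q31 q22 q13 q04 r := by
    funext u v
    simp only [hdef, quarticAdd]
    ring
  have hflat : Flat 4 r := ⟨hr, hjet⟩
  have hs : Smooth2 h := hh ▸ hflat.smooth.quarticAdd
  have hjets (s : ℝ) := hasJet2_cusp_of_gauss q21 q03 q40 q31 q22 q13 q04 s hflat hh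
  obtain ⟨-, jA, ⟨_, jB⟩, ⟨_, _, jC⟩⟩ := hjets 0
  have hA : Abde h 0 0 = 0 := by simpa using jA.apply_zero
  have hB : Bbde h 0 0 = 0 := by simpa using jB.apply_zero
  have hC : Cbde h 0 0 = -48 * q21 ^ 2 := by simpa using jC.apply_zero
  have hdelta (s : ℝ) : HasJet2 (fun t => deltaBde h t (s * t ^ 2)) 0 0
      (9216 * q21 ^ 2 * (q21 ^ 2 - 4 * q40) * (2 * (4 * q21 ^ 2 - 17 * q40)) +
        -(9216 * q21 ^ 3 * (q21 ^ 2 - 4 * q40)) * s) := by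
    obtain ⟨-, jA, ⟨_, jB⟩, ⟨_, _, jC⟩⟩ := hjets s
    exact (jB.sq.sub (jA.mul jC)).of_eq (by ring) (by ring) (by ring)
  refine ⟨hA, hB, hC, fun a b _ => ?_, ?_⟩
  · simp [hA, hB, hC, hq21]
  · obtain ⟨η₁, hη₁, h0₁, hd₁, hdd₁, hz₁⟩ :=
      hs.hessDet.exists_zero_curve (mul_ne_zero four_ne_zero hq21) fun s => (hjets s).1
    obtain ⟨η₂, hη₂, h0₂, hd₂, hdd₂, hz₂⟩ := hs.deltaBde.exists_zero_curve
      (neg_ne_zero.2 (mul_ne_zero (mul_ne_zero (by norm_num) (pow_ne_zero 3 hq21)) hnd)) hdelta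
    refine ⟨η₁, η₂, hη₁, hη₂, h0₁, h0₂, hd₁, hd₂, ?_, ?_, hz₁, hz₂, hd₁.trans hd₂.symm⟩
    · rw [hdd₁]
      field_simp
      ring
    · rw [hdd₂]
      field_simp

end
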